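/- arXiv:1605.09601 — 2 statements merged into one kernel-verified Lean document; each statement's English description precedes it below -/
import Mathlib

section
/- Fix ρ > 1. There exist constants A, B > 0 depending only on ρ such that the following holds (undersampled regime). Let Q > 0 and 0 < ε < Q with log(Q/ε)/log(ρ) ≥ (1/2)√N for a positive integer N. Let f be given on [-1, (ρ+ρ⁻¹)/2) by a Chebyshev series f(x) = Σ_{n≥0} a_n T_n(x) whose coefficients satisfy |a_0| ≤ Q and |a_n| ≤ 2Q ρ^{-n} for n ≥ 1. Let ε_vec ∈ ℝ^{N+1} satisfy ‖ε_vec‖_∞ ≤ ε, set M* = ⌊(1/2)√N⌋, let c ∈ ℝ^{M*+1} solve the normal equations T_{M*}(x^{equi})ᵀ T_{M*}(x^{equi}) c = T_{M*}(x^{equi})ᵀ (f(x^{equi}) + ε_vec), and let e(x) = Σ_{k=0}^{M*} c_k T_k(x). Then for every x ∈ [1, (ρ+ρ⁻¹)/2), with r(x) = (x + √(x²−1))/ρ, one has |f(x) − e(x)| ≤ A (1 + N)^B · (Q/(1 − r(x))) · r(x)^{(1/2)√N}. -/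
open Matrix MeasureTheory
open scoped BigOperators

/-- Chebyshev polynomial of the first kind `T_n`, as a function `ℝ → ℝ`. -/
noncomputable def cheb (n : ℕ) (x : ℝ) : ℝ :=
  (Polynomial.Chebyshev.T ℝ (n : ℤ)).eval x

/-- The equally spaced grid `x_k = 2k/N - 1`, `k = 0, …, N`, on `[-1,1]`. -/
noncomputable def xequi (N : ℕ) (k : Fin (N + 1)) : ℝ :=
  2 * (k : ℝ) / (N : ℝ) - 1

/-- The `(N+1) × (M+1)` Chebyshev–Vandermonde matrix at the equally spaced grid. -/
noncomputable def chebVand (N M : ℕ) : Matrix (Fin (N + 1)) (Fin (M + 1)) ℝ :=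
  Matrix.of fun i j => cheb (j : ℕ) (xequi N i)

/-- The Euclidean norm of a vector in `ℝ^n`. -/
noncomputable def enorm2 {n : ℕ} (v : Fin n → ℝ) : ℝ :=
  Real.sqrt (∑ i, (v i) ^ 2)

/-- The smallest singular value of a matrix, as the infimum of `‖A v‖₂` over unit vectors. -/
noncomputable def sigmaMin {m n : ℕ} (A : Matrix (Fin m) (Fin n) ℝ) : ℝ :=
  sInf {r | ∃ v : Fin n → ℝ, enorm2 v = 1 ∧ r = enorm2 (A.mulVec v)}

/-- The largest singular value of a matrix, as the supremum of `‖A v‖₂` over unit vectors. -/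
noncomputable def sigmaMax {m n : ℕ} (A : Matrix (Fin m) (Fin n) ℝ) : ℝ :=
  sSup {r | ∃ v : Fin n → ℝ, enorm2 v = 1 ∧ r = enorm2 (A.mulVec v)}

open Polynomial in
/-- A weak form of Markov's inequality at points of `[0, 1]`. -/
theorem eval_derivative_le_of_nonneg {P : ℝ[X]} {n : ℕ} {K y : ℝ} (hK : 0 < K)
    (hdeg : P.degree ≤ n) (hP : ∀ x ∈ Set.Icc (-1 : ℝ) 1, |P.eval x| ≤ K)
    (hy : y ∈ Set.Icc (0 : ℝ) 1) : (derivative P).eval y ≤ 2 * (n : ℝ) ^ 2 * K := by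
  obtain ⟨hy0, hy1⟩ := hy
  set R : ℝ[X] := C K⁻¹ * P.comp (C ((1 + y) / 2) * X + C ((y - 1) / 2)) with hR
  have hlin : (C ((1 + y) / 2) * X + C ((y - 1) / 2) : ℝ[X]).natDegree ≤ 1 :=
    natDegree_linear_le
  have hRdeg : R.degree ≤ n := by
    refine degree_le_of_natDegree_le ((natDegree_C_mul_le _ _).trans (natDegree_comp_le.trans ?_))
    calc _ ≤ P.natDegree * 1 := Nat.mul_le_mul_left _ hlin
      _ ≤ n := by simpa using natDegree_le_of_degree_le hdeg
  have hRbnd : ∀ x ∈ Set.Icc (-1 : ℝ) 1, |R.eval x| ≤ 1 := by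
    rintro x ⟨hx0, hx1⟩
    have := hP ((1 + y) / 2 * x + (y - 1) / 2) ⟨by nlinarith, by nlinarith⟩
    simp only [hR, eval_mul, eval_C, eval_comp, eval_add, eval_X, abs_mul, abs_inv, abs_of_pos hK]
    rw [inv_mul_le_iff₀ hK, mul_one]
    exact this
  have h := Chebyshev.eval_iterate_derivative_le_of_forall_abs_le_one (k := 1) le_rfl hRdeg hRbnd
  have hT : (derivative (Chebyshev.T ℝ n)).eval 1 = (n : ℝ) ^ 2 := by
    simp [Chebyshev.T_derivative_eq_U, sq]
  have hR' : (derivative R).eval 1 = K⁻¹ * ((1 + y) / 2 * (derivative P).eval y) := by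
    have : (1 + y) / 2 * 1 + (y - 1) / 2 = y := by ring
    simp only [hR, derivative_comp, derivative_C_mul, eval_mul, eval_C, eval_comp, eval_add,
      eval_X, this, derivative_add, derivative_X, derivative_C, eval_one, eval_zero]
    ring
  simp only [Function.iterate_one, hT, hR'] at h
  rw [inv_mul_le_iff₀ hK] at h
  rcases le_total ((derivative P).eval y) 0 with h0 | h0
  · exact h0.trans (by positivity)
  · nlinarith

open Polynomial in
/-- A weak form of Markov's inequality on `[-1, 1]`, with constant `2`. -/
theorem abs_eval_derivative_le {P : ℝ[X]} {n : ℕ} {K y : ℝ} (hK : 0 < K)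
    (hdeg : P.degree ≤ n) (hP : ∀ x ∈ Set.Icc (-1 : ℝ) 1, |P.eval x| ≤ K)
    (hy : y ∈ Set.Icc (-1 : ℝ) 1) : |(derivative P).eval y| ≤ 2 * (n : ℝ) ^ 2 * K := by
  have key : ∀ {P : ℝ[X]}, P.degree ≤ n → (∀ x ∈ Set.Icc (-1 : ℝ) 1, |P.eval x| ≤ K) →
      ∀ {y : ℝ}, y ∈ Set.Icc (0 : ℝ) 1 → |(derivative P).eval y| ≤ 2 * (n : ℝ) ^ 2 * K := by
    intro P hdeg hP y hy
    refine abs_le'.2 ⟨eval_derivative_le_of_nonneg hK hdeg hP hy, ?_⟩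
    have := eval_derivative_le_of_nonneg (P := -P) hK (by rwa [degree_neg])
      (by simpa using hP) hy
    simpa using this
  rcases le_total 0 y with h | h
  · exact key hdeg hP ⟨h, hy.2⟩
  · have hdeg' : (P.comp (-X)).degree ≤ n := by
      refine degree_le_of_natDegree_le (natDegree_comp_le.trans ?_)
      simpa using natDegree_le_of_degree_le hdeg
    have := key hdeg' (fun x hx => by
      simpa using hP (-x) ⟨by linarith [hx.2], by linarith [hx.1]⟩)
      (y := -y) ⟨by linarith, by linarith [hy.1]⟩
    simpa [derivative_comp] using this

theorem xequi_mem_Icc (N : ℕ) (k : Fin (N + 1)) : xequi N k ∈ Set.Icc (-1 : ℝ) 1 := by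
  have hk : (k : ℝ) ≤ N := by exact_mod_cast Nat.lt_succ_iff.1 k.2
  have h0 : 0 ≤ 2 * (k : ℝ) / N := by positivity
  have h1 : 2 * (k : ℝ) / N ≤ 2 := div_le_of_le_mul₀ (by positivity) (by norm_num) (by linarith)
  exact ⟨by unfold xequi; linarith, by unfold xequi; linarith⟩

theorem exists_abs_sub_xequi_le {N : ℕ} (hN : 0 < N) {z : ℝ} (hz : z ∈ Set.Icc (-1 : ℝ) 1) :
    ∃ k, |z - xequi N k| ≤ 1 / N := by
  have hN' : (0 : ℝ) < N := by exact_mod_cast hN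
  have hz0 : 0 ≤ (z + 1) * N / 2 + 1 / 2 := by
    have := mul_nonneg (by linarith [hz.1] : 0 ≤ z + 1) hN'.le
    linarith
  have h1 := Nat.floor_le hz0
  have h2 := Nat.lt_floor_add_one ((z + 1) * N / 2 + 1 / 2)
  have hlt : ⌊(z + 1) * N / 2 + 1 / 2⌋₊ < N + 1 := by
    rw [Nat.floor_lt hz0]
    push_cast
    nlinarith [hz.2]
  refine ⟨⟨_, hlt⟩, ?_⟩
  have : z - xequi N ⟨_, hlt⟩ =
      ((z + 1) * N - 2 * (⌊(z + 1) * N / 2 + 1 / 2⌋₊ : ℝ)) / N := by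
    simp only [xequi]
    field_simp
    ring
  rw [this, abs_div, abs_of_pos hN']
  gcongr
  rw [abs_le]
  constructor <;> linarith

open Polynomial in
/-- A polynomial of degree `n` with `4 n² ≤ N` is controlled on `[-1, 1]` by its values on the
equally spaced grid with `N + 1` points. -/
theorem abs_eval_le_of_abs_eval_xequi_le {P : ℝ[X]} {n N : ℕ} (hN : 0 < N)
    (hdeg : P.degree ≤ n) (hn : 4 * (n : ℝ) ^ 2 ≤ N) {W : ℝ}
    (hW : ∀ i, |P.eval (xequi N i)| ≤ W) {x : ℝ} (hx : x ∈ Set.Icc (-1 : ℝ) 1) :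
    |P.eval x| ≤ 2 * W := by
  have hN' : (0 : ℝ) < N := by exact_mod_cast hN
  obtain ⟨z, hz, hmax⟩ := isCompact_Icc.exists_isMaxOn (s := Set.Icc (-1 : ℝ) 1)
    (f := fun x => |P.eval x|) ⟨0, by norm_num⟩ (by fun_prop)
  have hmax' : ∀ x ∈ Set.Icc (-1 : ℝ) 1, |P.eval x| ≤ |P.eval z| := fun x hx => hmax hx
  refine (hmax' x hx).trans ?_
  rcases (abs_nonneg (P.eval z)).eq_or_lt with h0 | hpos
  · linarith [(abs_nonneg _).trans (hW 0)]
  obtain ⟨k, hk⟩ := exists_abs_sub_xequi_le hN hz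
  have hmvt := (convex_Icc (-1 : ℝ) 1).norm_image_sub_le_of_norm_deriv_le
    (f := fun x => P.eval x) (C := 2 * (n : ℝ) ^ 2 * |P.eval z|)
    (fun x _ => P.differentiable.differentiableAt)
    (fun x hx => by
      rw [Polynomial.deriv]; exact abs_eval_derivative_le hpos hdeg hmax' hx)
    (xequi_mem_Icc N k) hz
  simp only [Real.norm_eq_abs] at hmvt
  have hb : 2 * (n : ℝ) ^ 2 * |P.eval z| * |z - xequi N k| ≤ |P.eval z| / 2 := by
    calc _ ≤ 2 * (n : ℝ) ^ 2 * |P.eval z| * (1 / N) := by gcongr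
      _ = 4 * (n : ℝ) ^ 2 * (|P.eval z| / 2) / N := by ring
      _ ≤ N * (|P.eval z| / 2) / N := by gcongr
      _ = |P.eval z| / 2 := by field_simp
  have := abs_sub_abs_le_abs_sub (P.eval z) (P.eval (xequi N k))
  linarith [hW k]

open Polynomial in
theorem abs_eval_le_mul_cheb {P : ℝ[X]} {n : ℕ} {K x : ℝ} (hdeg : P.degree ≤ n)
    (hP : ∀ y ∈ Set.Icc (-1 : ℝ) 1, |P.eval y| ≤ K) (hK : 0 < K) (hx : 1 ≤ x) :
    |P.eval x| ≤ K * cheb n x := by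
  have key : ∀ s : ℝ, |s| = K⁻¹ → s * P.eval x ≤ cheb n x := by
    intro s hs
    have := Chebyshev.eval_iterate_derivative_le_of_forall_abs_le_one (k := 0) (P := C s * P) hx
      (degree_le_of_natDegree_le
        ((natDegree_C_mul_le s P).trans (natDegree_le_of_degree_le hdeg))) (fun y hy => by
        rw [eval_mul, eval_C, abs_mul, hs, inv_mul_le_iff₀ hK, mul_one]
        exact hP y hy)
    simpa [cheb] using this
  have h1 := key K⁻¹ (by rw [abs_of_pos (inv_pos.2 hK)])
  have h2 := key (-K⁻¹) (by rw [abs_neg, abs_of_pos (inv_pos.2 hK)])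
  rw [inv_mul_le_iff₀ hK] at h1
  rw [neg_mul, ← mul_neg, inv_mul_le_iff₀ hK] at h2
  exact abs_le'.2 ⟨h1, h2⟩

theorem abs_cheb_le_one (n : ℕ) {x : ℝ} (hx : x ∈ Set.Icc (-1 : ℝ) 1) : |cheb n x| ≤ 1 :=
  Polynomial.Chebyshev.abs_eval_T_real_le_one n (abs_le.2 hx)

theorem abs_cheb_le_pow (n : ℕ) {x : ℝ} (hx : 1 ≤ x) :
    |cheb n x| ≤ (x + √(x ^ 2 - 1)) ^ n := by
  have hu : 0 ≤ n * Real.arcosh x := mul_nonneg n.cast_nonneg (Real.arcosh_nonneg hx)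
  rw [← Real.exp_arcosh hx, ← Real.exp_nat_mul, cheb]
  nth_rewrite 1 [← Real.cosh_arcosh hx]
  rw [Polynomial.Chebyshev.T_real_cosh, Int.cast_natCast, abs_of_pos (Real.cosh_pos _),
    Real.cosh_eq]
  have : Real.exp (-(n * Real.arcosh x)) ≤ Real.exp (n * Real.arcosh x) :=
    Real.exp_le_exp.2 (by linarith)
  linarith

/-- Tail bound for a Chebyshev series with geometrically decaying coefficients. -/
theorem abs_sub_sum_cheb_le {ρ Q y x s : ℝ} {a : ℕ → ℝ} (hρ : 0 < ρ)
    (hy0 : 0 ≤ y) (hyρ : y < ρ) (hT : ∀ n, |cheb n x| ≤ y ^ n)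
    (ha : ∀ n : ℕ, 1 ≤ n → |a n| ≤ 2 * Q * ρ ^ (-(n : ℤ)))
    (hs : HasSum (fun n : ℕ => a n * cheb n x) s) (M : ℕ) :
    |s - ∑ n ∈ Finset.range (M + 1), a n * cheb n x| ≤
      2 * Q * (y / ρ) ^ (M + 1) / (1 - y / ρ) := by
  have hr0 : 0 ≤ y / ρ := by positivity
  have hr1 : y / ρ < 1 := (div_lt_one hρ).2 hyρ
  have htail := (hasSum_nat_add_iff' (M + 1)).2 hs
  have hgeo := (hasSum_geometric_of_lt_one hr0 hr1).mul_left (2 * Q * (y / ρ) ^ (M + 1))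
  rw [div_eq_mul_inv, ← htail.tsum_eq, ← Real.norm_eq_abs]
  refine tsum_of_norm_bounded hgeo fun n => ?_
  rw [Real.norm_eq_abs, abs_mul]
  calc _ ≤ 2 * Q * ρ ^ (-((n + (M + 1) : ℕ) : ℤ)) * y ^ (n + (M + 1)) :=
        mul_le_mul (ha _ (by omega)) (hT _) (abs_nonneg _)
          ((abs_nonneg _).trans (ha _ (by omega)))
    _ = _ := by
      rw [_root_.zpow_neg, zpow_natCast, mul_assoc (2 * Q) _ ((y / ρ) ^ n), ← pow_add, div_pow,
        add_comm (M + 1) n]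
      ring

/-- The fitted values of a least squares solution are bounded by the data that is fitted. -/
theorem sum_sq_mulVec_le_of_normal_equations {m n : ℕ} {A : Matrix (Fin m) (Fin n) ℝ}
    {v : Fin n → ℝ} {d : Fin m → ℝ} (h : Aᵀ *ᵥ (A *ᵥ v) = Aᵀ *ᵥ d) :
    ∑ i, (A *ᵥ v) i ^ 2 ≤ ∑ i, d i ^ 2 := by
  have h1 : (A *ᵥ v) ⬝ᵥ (A *ᵥ v) = (A *ᵥ v) ⬝ᵥ d := by
    have := congrArg (fun u => v ⬝ᵥ u) h
    simpa only [dotProduct_mulVec, vecMul_transpose] using this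
  simp only [dotProduct] at h1
  have h2 : 0 ≤ ∑ i, ((A *ᵥ v) i - d i) ^ 2 := Finset.sum_nonneg fun i _ => sq_nonneg _
  have h3 : ∑ i, ((A *ᵥ v) i - d i) ^ 2 = ∑ i, (A *ᵥ v) i * (A *ᵥ v) i
      - 2 * ∑ i, (A *ᵥ v) i * d i + ∑ i, d i ^ 2 := by
    rw [Finset.mul_sum, ← Finset.sum_sub_distrib, ← Finset.sum_add_distrib]
    exact Finset.sum_congr rfl fun i _ => by ring
  have h4 : ∑ i, (A *ᵥ v) i ^ 2 = ∑ i, (A *ᵥ v) i * (A *ᵥ v) i :=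
    Finset.sum_congr rfl fun i _ => sq _
  linarith

theorem abs_mulVec_le_of_normal_equations {N n : ℕ} {A : Matrix (Fin (N + 1)) (Fin n) ℝ}
    {v : Fin n → ℝ} {d : Fin (N + 1) → ℝ} {D : ℝ} (h : Aᵀ *ᵥ (A *ᵥ v) = Aᵀ *ᵥ d)
    (hd : ∀ i, |d i| ≤ D) (i : Fin (N + 1)) : |(A *ᵥ v) i| ≤ (1 + N) * D := by
  have hD : 0 ≤ D := (abs_nonneg _).trans (hd 0)
  refine abs_le_of_sq_le_sq ?_ (by positivity)
  calc (A *ᵥ v) i ^ 2 ≤ ∑ i, (A *ᵥ v) i ^ 2 :=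
        Finset.single_le_sum (f := fun i => (A *ᵥ v) i ^ 2) (fun i _ => sq_nonneg _)
          (Finset.mem_univ i)
    _ ≤ ∑ i, d i ^ 2 := sum_sq_mulVec_le_of_normal_equations h
    _ ≤ ∑ _i : Fin (N + 1), D ^ 2 := Finset.sum_le_sum fun i _ => sq_le_sq'
        (abs_le.1 (hd i)).1 (abs_le.1 (hd i)).2
    _ = (1 + N) * D ^ 2 := by simp [add_comm]
    _ ≤ ((1 + N) * D) ^ 2 := by
      have : (1 : ℝ) ≤ 1 + N := by simp
      rw [mul_pow]
      gcongr
      exact le_self_pow₀ this two_ne_zero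

theorem chebVand_mulVec (N M : ℕ) (v : Fin (M + 1) → ℝ) (i : Fin (N + 1)) :
    (chebVand N M *ᵥ v) i = ∑ k : Fin (M + 1), v k * cheb (k : ℕ) (xequi N i) := by
  simp [chebVand, mulVec, dotProduct, mul_comm]

open Polynomial in
/-- Growth on `[1, ∞)` of a Chebyshev sum bounded by `W` on a fine equally spaced grid. -/
theorem abs_sum_cheb_le_of_abs_xequi_le {N M : ℕ} (hN : 0 < N) (hM : 4 * (M : ℝ) ^ 2 ≤ N)
    {v : Fin (M + 1) → ℝ} {W : ℝ} (hW0 : 0 < W)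
    (hW : ∀ i, |∑ k : Fin (M + 1), v k * cheb (k : ℕ) (xequi N i)| ≤ W) {x : ℝ} (hx : 1 ≤ x) :
    |∑ k : Fin (M + 1), v k * cheb (k : ℕ) x| ≤ 2 * W * (x + √(x ^ 2 - 1)) ^ M := by
  set P : ℝ[X] := ∑ k : Fin (M + 1), C (v k) * Chebyshev.T ℝ (k : ℕ) with hP
  have heval : ∀ y, P.eval y = ∑ k : Fin (M + 1), v k * cheb (k : ℕ) y := fun y => by
    simp [hP, eval_finsetSum, cheb]
  have hdeg : P.degree ≤ M := by
    refine degree_le_of_natDegree_le (natDegree_sum_le_of_forall_le _ _ fun k _ => ?_)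
    refine (natDegree_C_mul_le _ _).trans (natDegree_le_of_degree_le ?_)
    simpa using Nat.lt_succ_iff.1 k.2
  simp only [← heval] at hW ⊢
  calc |P.eval x| ≤ 2 * W * cheb M x :=
        abs_eval_le_mul_cheb hdeg
          (fun y hy => abs_eval_le_of_abs_eval_xequi_le hN hdeg hM hW hy) (by positivity) hx
    _ ≤ _ := by
      gcongr
      exact (le_abs_self _).trans (abs_cheb_le_pow M hx)

theorem add_sqrt_sq_sub_one_lt {ρ x : ℝ} (hρ : 1 < ρ) (hx : x < (ρ + ρ⁻¹) / 2) :
    x + √(x ^ 2 - 1) < ρ := by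
  have h0 : 0 < ρ := by linarith
  have hinv : ρ⁻¹ < ρ := (inv_lt_one_of_one_lt₀ hρ).trans hρ
  have hmul : ρ * ρ⁻¹ = 1 := mul_inv_cancel₀ h0.ne'
  have : √(x ^ 2 - 1) < ρ - x := by
    rw [Real.sqrt_lt' (by linarith)]
    nlinarith
  linarith

/-- **Undersampled regime** (Theorem 1.2, second part, of the paper): if
`log(Q/ε)/log ρ ≥ √N / 2`, the degree-`M*` least squares Chebyshev fit with
`M* = ⌊√N/2⌋` computed from `ε`-perturbed equally spaced samples of `f ∈ B_ρ(Q)`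
satisfies, for all `x ∈ [1, (ρ+ρ⁻¹)/2)`,
`|f(x) − e(x)| ≤ A (1 + N)^B (Q/(1−r)) r^{√N/2}` with `r = (x+√(x²−1))/ρ`
and constants `A, B` depending only on `ρ`. -/
theorem undersampled_extrapolation (ρ : ℝ) (hρ : 1 < ρ) :
    ∃ A B : ℝ, 0 < A ∧ 0 < B ∧
      ∀ (Q ε : ℝ) (N : ℕ) (f : ℝ → ℝ) (a : ℕ → ℝ) (εvec : Fin (N + 1) → ℝ) (Mstar : ℕ)
        (c : Fin (Mstar + 1) → ℝ),
        0 < Q → 0 < ε → ε < Q → 0 < N →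
        Real.sqrt (N : ℝ) / 2 ≤ Real.log (Q / ε) / Real.log ρ →
        Mstar = ⌊Real.sqrt (N : ℝ) / 2⌋₊ →
        (∀ x ∈ Set.Ico (-1 : ℝ) ((ρ + ρ⁻¹) / 2),
          HasSum (fun n : ℕ => a n * cheb n x) (f x)) →
        |a 0| ≤ Q →
        (∀ n : ℕ, 1 ≤ n → |a n| ≤ 2 * Q * ρ ^ (-(n : ℤ))) →
        (∀ i, |εvec i| ≤ ε) →
        ((chebVand N Mstar).transpose * chebVand N Mstar) *ᵥ c =
          (chebVand N Mstar).transpose *ᵥ (fun i => f (xequi N i) + εvec i) →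
        ∀ x ∈ Set.Ico (1 : ℝ) ((ρ + ρ⁻¹) / 2),
          |f x - ∑ k : Fin (Mstar + 1), c k * cheb (k : ℕ) x| ≤
            A * (1 + (N : ℝ)) ^ B *
              (Q / (1 - (x + Real.sqrt (x ^ 2 - 1)) / ρ)) *
              ((x + Real.sqrt (x ^ 2 - 1)) / ρ) ^ (Real.sqrt (N : ℝ) / 2) := by
  have hρ0 : 0 < ρ := by linarith
  set C : ℝ := 2 / (1 - 1 / ρ) + 1 with hC
  have hρ1 : 0 < 1 - 1 / ρ := by rw [sub_pos, div_lt_one hρ0]; exact hρ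
  have hC0 : 0 < C := by positivity
  refine ⟨2 + 2 * C * ρ, 1, by positivity, one_pos, ?_⟩
  rintro Q ε N f a εvec M c hQ hε - hN hlog hM hf - ha hεvec hc x ⟨hx1, hx2⟩
  have hs0 : 0 ≤ √(N : ℝ) / 2 := by positivity
  have hMs : (M : ℝ) ≤ √(N : ℝ) / 2 := hM ▸ Nat.floor_le hs0
  have hsM : √(N : ℝ) / 2 ≤ ((M + 1 : ℕ) : ℝ) := by
    rw [hM]; exact_mod_cast (Nat.lt_floor_add_one (√(N : ℝ) / 2)).le
  have hM4 : 4 * (M : ℝ) ^ 2 ≤ N := by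
    have := Real.sq_sqrt (Nat.cast_nonneg (α := ℝ) N)
    nlinarith [Nat.cast_nonneg (α := ℝ) M]
  have hεQ : ε ≤ Q * (1 / ρ) ^ M := by
    have h1 : M * Real.log ρ ≤ Real.log (Q / ε) :=
      (le_div_iff₀ (Real.log_pos hρ)).1 (hMs.trans hlog)
    rw [← Real.log_pow, Real.log_le_log_iff (by positivity) (by positivity),
      le_div_iff₀ hε] at h1
    rw [one_div, inv_pow, ← div_eq_mul_inv, le_div_iff₀ (by positivity)]
    linarith
  set y := x + √(x ^ 2 - 1) with hy
  have hy1 : 1 ≤ y := le_add_of_le_of_nonneg hx1 (Real.sqrt_nonneg _)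
  have hyρ : y < ρ := add_sqrt_sq_sub_one_lt hρ hx2
  have hr0 : 0 < y / ρ := by positivity
  have hr1 : y / ρ < 1 := (div_lt_one hρ0).2 hyρ
  have hinterval : ∀ z ∈ Set.Icc (-1 : ℝ) 1, z ∈ Set.Ico (-1 : ℝ) ((ρ + ρ⁻¹) / 2) :=
    fun z hz => ⟨hz.1, hz.2.trans_lt (hx1.trans_lt hx2)⟩
  set d : Fin (N + 1) → ℝ := fun i =>
    f (xequi N i) - ∑ n ∈ Finset.range (M + 1), a n * cheb n (xequi N i) + εvec i with hd
  set v : Fin (M + 1) → ℝ := fun k => c k - a k with hv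
  have hdbound : ∀ i, |d i| ≤ C * Q * (1 / ρ) ^ M := by
    intro i
    have hxi := xequi_mem_Icc N i
    have h1 := abs_sub_sum_cheb_le hρ0 zero_le_one hρ
      (fun n => by simpa using abs_cheb_le_one n hxi) ha (hf _ (hinterval _ hxi)) M
    have h2 : 2 * Q * (1 / ρ) ^ (M + 1) / (1 - 1 / ρ) ≤ 2 * Q * (1 / ρ) ^ M / (1 - 1 / ρ) := by
      gcongr ?_ / _
      gcongr 2 * Q * ?_
      exact pow_le_pow_of_le_one (by positivity) (by linarith) M.le_succ
    calc |d i| ≤ _ + |εvec i| := abs_add_le _ _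
      _ ≤ 2 * Q * (1 / ρ) ^ M / (1 - 1 / ρ) + Q * (1 / ρ) ^ M :=
        add_le_add (h1.trans h2) ((hεvec i).trans hεQ)
      _ = C * Q * (1 / ρ) ^ M := by rw [hC]; ring
  have hnormal : (chebVand N M)ᵀ *ᵥ (chebVand N M *ᵥ v) = (chebVand N M)ᵀ *ᵥ d := by
    have hvc : v = c - fun k : Fin (M + 1) => a k := rfl
    have hdc : d = (fun i => f (xequi N i) + εvec i) -
        chebVand N M *ᵥ fun k : Fin (M + 1) => a k := by
      ext i
      rw [Pi.sub_apply, chebVand_mulVec, hd,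
        Fin.sum_univ_eq_sum_range (fun n => a n * cheb n (xequi N i))]
      ring
    rw [hvc, hdc, mulVec_sub, mulVec_sub, mulVec_sub, ← hc, mulVec_mulVec]
  have hgrid : ∀ i, |∑ k : Fin (M + 1), v k * cheb (k : ℕ) (xequi N i)| ≤
      (1 + N) * (C * Q * (1 / ρ) ^ M) := fun i => by
    rw [← chebVand_mulVec]
    exact abs_mulVec_le_of_normal_equations hnormal hdbound i
  have hfit := abs_sum_cheb_le_of_abs_xequi_le hN hM4 (by positivity) hgrid hx1
  have htail := abs_sub_sum_cheb_le hρ0 (by positivity) hyρ (fun n => abs_cheb_le_pow n hx1) ha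
    (hf x ⟨by linarith, hx2⟩) M
  have hsplit : f x - ∑ k : Fin (M + 1), c k * cheb (k : ℕ) x =
      (f x - ∑ n ∈ Finset.range (M + 1), a n * cheb n x) -
        ∑ k : Fin (M + 1), v k * cheb (k : ℕ) x := by
    rw [← Fin.sum_univ_eq_sum_range (fun n => a n * cheb n x)]
    simp only [hv, sub_mul, Finset.sum_sub_distrib]
    ring
  set R := (y / ρ) ^ (√(N : ℝ) / 2) with hR
  have hR0 : 0 < R := Real.rpow_pos_of_pos hr0 _
  have hpow1 : (y / ρ) ^ (M + 1) ≤ R := by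
    rw [hR, ← Real.rpow_natCast]
    exact Real.rpow_le_rpow_of_exponent_ge hr0 hr1.le hsM
  have hpow : (y / ρ) ^ M ≤ ρ * R := by
    have : (y / ρ) ^ M ≤ (y / ρ) ^ M * y := le_mul_of_one_le_right (by positivity) hy1
    calc (y / ρ) ^ M ≤ ρ * (y / ρ) ^ (M + 1) := by
          rw [pow_succ]; field_simp at this ⊢; exact this
      _ ≤ ρ * R := by gcongr
  have hQr : Q ≤ Q / (1 - y / ρ) :=
    le_div_self hQ.le (by linarith) (by linarith)
  have hG0 : 0 < Q / (1 - y / ρ) := hQ.trans_le hQr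
  rw [hsplit, Real.rpow_one]
  calc _ ≤ _ := abs_sub _ _
    _ ≤ 2 * Q * (y / ρ) ^ (M + 1) / (1 - y / ρ) +
        2 * ((1 + N) * (C * Q * (1 / ρ) ^ M)) * y ^ M := add_le_add htail hfit
    _ = 2 * (Q / (1 - y / ρ)) * (y / ρ) ^ (M + 1) + 2 * (1 + N) * C * Q * (y / ρ) ^ M := by
      rw [div_pow y ρ M, one_div, inv_pow]; ring
    _ ≤ 2 * (Q / (1 - y / ρ)) * R + 2 * (1 + N) * C * (Q / (1 - y / ρ)) * (ρ * R) := by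
      gcongr
    _ ≤ 2 * (1 + N) * (Q / (1 - y / ρ)) * R +
        2 * (1 + N) * C * (Q / (1 - y / ρ)) * (ρ * R) := by
      gcongr ?_ * _ * _ + _
      linarith [Nat.cast_nonneg (α := ℝ) N]
    _ = _ := by ring
end

section
/- Let M and N be nonnegative integers with M ≤ (1/2)√N, let T_M(x^{equi}) be the (N+1)×(M+1) Chebyshev–Vandermonde matrix with (i,j) entry T_j(x_i^{equi}), and let P_M(x^{equi}) be the (N+1)×(M+1) Legendre–Vandermonde matrix with (i,j) entry P_j(x_i^{equi}), where x_k^{equi} = 2k/N − 1. Then σ₁(T_M(x^{equi}))² ≤ 3N, and σ_{M+1}(T_M(x^{equi}))² ≥ (1/25) σ_{M+1}(P_M(x^{equi}))². -/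
open Matrix MeasureTheory
open scoped BigOperators

/-- The Legendre polynomials, via the three-term recurrence
`(n+2) P_{n+2} = (2n+3) x P_{n+1} - (n+1) P_n`, normalized so that `P_n(1) = 1`. -/
noncomputable def legendre : ℕ → Polynomial ℝ
  | 0 => 1
  | 1 => Polynomial.X
  | n + 2 =>
      Polynomial.C ((2 * (n : ℝ) + 3) / ((n : ℝ) + 2)) * (Polynomial.X * legendre (n + 1)) -
        Polynomial.C (((n : ℝ) + 1) / ((n : ℝ) + 2)) * legendre n

/-- The `(N+1) × (M+1)` Legendre–Vandermonde matrix at the equally spaced grid. -/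
noncomputable def legVand (N M : ℕ) : Matrix (Fin (N + 1)) (Fin (M + 1)) ℝ :=
  Matrix.of fun i j => (legendre (j : ℕ)).eval (xequi N i)

/-- The law of a vector of `N+1` independent mean-zero Gaussians of variance `s²`. -/
noncomputable def gaussVec (N : ℕ) (s : ℝ) : Measure (Fin (N + 1) → ℝ) :=
  Measure.pi fun _ => ProbabilityTheory.gaussianReal 0 ⟨s ^ 2, sq_nonneg s⟩

section

open Finset

/-- The Wallis ratio `(2k choose k) / 4 ^ k`. -/
noncomputable def wallis (k : ℕ) : ℝ := (k.centralBinom : ℝ) / 4 ^ k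

theorem wallis_pos (k : ℕ) : 0 < wallis k :=
  div_pos (by exact_mod_cast k.centralBinom_pos) (by positivity)

theorem wallis_zero : wallis 0 = 1 := by simp [wallis]

theorem wallis_succ (k : ℕ) : (2 * k + 2) * wallis (k + 1) = (2 * k + 1) * wallis k := by
  have h : ((k : ℝ) + 1) * (k + 1).centralBinom = 2 * (2 * k + 1) * k.centralBinom := by
    exact_mod_cast k.succ_mul_centralBinom_succ
  unfold wallis
  rw [pow_succ]
  field_simp
  linarith

theorem wallis_sq_le (k : ℕ) : (2 * k + 1) * wallis k ^ 2 ≤ 1 := by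
  induction k with
  | zero => simp [wallis_zero]
  | succ k ih =>
    have h := wallis_succ k
    have h2 : (2 * (k : ℝ) + 2) ^ 2 * wallis (k + 1) ^ 2 = (2 * k + 1) ^ 2 * wallis k ^ 2 := by
      rw [← mul_pow, ← mul_pow, h]
    have h3 : wallis (k + 1) ^ 2 = (2 * k + 1) ^ 2 * wallis k ^ 2 / (2 * (k : ℝ) + 2) ^ 2 := by
      field_simp; linarith
    rw [h3, mul_div_assoc', div_le_one (by positivity)]
    push_cast
    have h4 := mul_le_mul_of_nonneg_left ih
      (show (0 : ℝ) ≤ (2 * ((k : ℝ) + 1) + 1) * (2 * k + 1) by positivity)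
    nlinarith

theorem wallis_le (k : ℕ) : wallis k ≤ 1 / √(2 * k + 1) := by
  have h := wallis_sq_le k
  rw [one_div, ← Real.sqrt_inv]
  apply Real.le_sqrt_of_sq_le
  rw [← one_div, le_div_iff₀ (by positivity)]
  linarith

/-- The shifted sequence `wallis (k - 1)`, extended by zero at `k = 0`. -/
noncomputable def wallisPred : ℕ → ℝ
  | 0 => 0
  | k + 1 => wallis k

theorem mul_wallis (k : ℕ) : (k : ℝ) * wallis k = (k - 1 / 2) * wallisPred k := by
  cases k with
  | zero => simp [wallisPred]
  | succ k =>
    have := wallis_succ k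
    simp only [wallisPred]
    push_cast
    linarith

theorem wallis_mul_recurrence (n k l : ℕ) (h : k + l = n + 2) :
    wallis k * wallis l = (2 * (n : ℝ) + 3) / (n + 2) *
      (1 / 2 * (wallis k * wallisPred l + wallisPred k * wallis l)) -
      (n + 1) / (n + 2) * (wallisPred k * wallisPred l) := by
  have hn : (n : ℝ) = k + l - 2 := by
    have : (k : ℝ) + l = n + 2 := by exact_mod_cast h
    linarith
  have hk := mul_wallis k
  have hl := mul_wallis l
  have hn2 : (n : ℝ) + 2 ≠ 0 := by positivity
  suffices hs : ((n : ℝ) + 2) * (wallis k * wallis l) = (2 * (n : ℝ) + 3) *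
      (1 / 2 * (wallis k * wallisPred l + wallisPred k * wallis l)) -
      (n + 1) * (wallisPred k * wallisPred l) by
    field_simp
    linarith
  rcases Nat.eq_zero_or_pos k with rfl | hk0
  · simp only [wallisPred, Nat.cast_zero] at *
    rw [hn]
    linear_combination wallis 0 * hl
  rcases Nat.eq_zero_or_pos l with rfl | hl0
  · simp only [wallisPred, Nat.cast_zero] at *
    rw [hn]
    linear_combination wallis 0 * hk
  have hk1 : (k : ℝ) ≠ 0 := by positivity
  have hl1 : (l : ℝ) ≠ 0 := by positivity
  have ek : wallis k = (k - 1 / 2) * wallisPred k / k := by field_simp; linarith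
  have el : wallis l = (l - 1 / 2) * wallisPred l / l := by field_simp; linarith
  rw [ek, el, hn]
  field_simp
  ring

open Polynomial in
open Polynomial.Chebyshev (T T_add_one) in
theorem legendre_eq_sum_chebyshev (n : ℕ) : legendre n = ∑ p ∈ antidiagonal n,
    C (wallis p.1 * wallis p.2) * T ℝ ((p.2 : ℤ) - p.1) := by
  induction n using Nat.twoStepInduction with
  | zero => simp [legendre, wallis_zero]
  | one =>
    have h : wallis 1 = 1 / 2 := by norm_num [wallis, Nat.centralBinom]
    have h2 : (2 : ℝ[X]) * C (1 / 2 : ℝ) = 1 := by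
      rw [show (2 : ℝ[X]) = C 2 from rfl, ← C_mul]; norm_num
    rw [Nat.sum_antidiagonal_succ]
    simp only [zero_add, HasAntidiagonal.antidiagonal_zero, sum_singleton, legendre, wallis_zero, h]
    simp at h2 ⊢
    linear_combination (-X : ℝ[X]) * h2
  | more n ih0 ih1 =>
    have s0 : legendre n = ∑ p ∈ antidiagonal (n + 2),
        C (wallisPred p.1 * wallisPred p.2) * T ℝ ((p.2 : ℤ) - p.1) := by
      rw [Nat.sum_antidiagonal_succ, Nat.sum_antidiagonal_succ', ih0]
      simp [wallisPred]
    have s1 : X * legendre (n + 1) = ∑ p ∈ antidiagonal (n + 2),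
        C (1 / 2 * (wallis p.1 * wallisPred p.2 + wallisPred p.1 * wallis p.2)) *
          T ℝ ((p.2 : ℤ) - p.1) := by
      have e1 : ∑ p ∈ antidiagonal (n + 2), C (wallis p.1 * wallisPred p.2) *
          T ℝ ((p.2 : ℤ) - p.1) = ∑ p ∈ antidiagonal (n + 1), C (wallis p.1 * wallis p.2) *
          T ℝ ((p.2 : ℤ) - p.1 + 1) := by
        rw [Nat.sum_antidiagonal_succ']
        simp [wallisPred, add_sub_right_comm]
      have e2 : ∑ p ∈ antidiagonal (n + 2), C (wallisPred p.1 * wallis p.2) *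
          T ℝ ((p.2 : ℤ) - p.1) = ∑ p ∈ antidiagonal (n + 1), C (wallis p.1 * wallis p.2) *
          T ℝ ((p.2 : ℤ) - p.1 - 1) := by
        rw [Nat.sum_antidiagonal_succ]
        simp [wallisPred, sub_sub]
      have e0 : ∑ p ∈ antidiagonal (n + 2),
          C (1 / 2 * (wallis p.1 * wallisPred p.2 + wallisPred p.1 * wallis p.2)) *
            T ℝ ((p.2 : ℤ) - p.1) =
          C (1 / 2) * (∑ p ∈ antidiagonal (n + 2), C (wallis p.1 * wallisPred p.2) *
            T ℝ ((p.2 : ℤ) - p.1) + ∑ p ∈ antidiagonal (n + 2),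
              C (wallisPred p.1 * wallis p.2) * T ℝ ((p.2 : ℤ) - p.1)) := by
        rw [← sum_add_distrib, mul_sum]
        refine sum_congr rfl fun p _ => ?_
        simp only [C_mul, C_add]
        ring
      rw [e0, e1, e2, ← sum_add_distrib, ih1, mul_sum, mul_sum]
      refine sum_congr rfl fun p _ => ?_
      have h := T_add_one ℝ ((p.2 : ℤ) - p.1)
      have h2 : (2 : ℝ[X]) * C (1 / 2 : ℝ) = 1 := by
        rw [show (2 : ℝ[X]) = C 2 from rfl, ← C_mul]; norm_num
      rw [h]
      linear_combination -X * C (wallis p.1 * wallis p.2) * T ℝ ((p.2 : ℤ) - p.1) * h2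
    rw [legendre, s0, s1, mul_sum, mul_sum, ← sum_sub_distrib]
    refine sum_congr rfl fun p hp => ?_
    rw [wallis_mul_recurrence n p.1 p.2 (mem_antidiagonal.1 hp)]
    simp only [C_mul, C_sub]
    ring

/-- The coefficient of `T_j` in the Chebyshev expansion of the Legendre polynomial `P_n`. -/
noncomputable def connCoeff (j n : ℕ) : ℝ :=
  ∑ p ∈ antidiagonal n, if ((p.2 : ℤ) - p.1).natAbs = j then wallis p.1 * wallis p.2 else 0

theorem connCoeff_nonneg (j n : ℕ) : 0 ≤ connCoeff j n :=
  sum_nonneg fun p _ => by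
    split_ifs
    · exact (mul_pos (wallis_pos _) (wallis_pos _)).le
    · exact le_rfl

theorem connCoeff_self_pos (n : ℕ) : 0 < connCoeff n n := by
  refine sum_pos' (fun p _ => ?_) ⟨(0, n), by simp, ?_⟩
  · split_ifs
    · exact (mul_pos (wallis_pos _) (wallis_pos _)).le
    · exact le_rfl
  · simpa using mul_pos (wallis_pos 0) (wallis_pos n)

theorem connCoeff_eq_zero {j n : ℕ} (h : n < j) : connCoeff j n = 0 := by
  refine sum_eq_zero fun p hp => if_neg ?_
  have := mem_antidiagonal.1 hp
  omega

theorem legendre_eval_eq_sum (M n : ℕ) (hn : n ≤ M) (x : ℝ) :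
    (legendre n).eval x = ∑ j ∈ range (M + 1), cheb j x * connCoeff j n := by
  simp only [connCoeff, mul_sum]
  rw [sum_comm, legendre_eq_sum_chebyshev, Polynomial.eval_finsetSum]
  refine sum_congr rfl fun p hp => ?_
  have := mem_antidiagonal.1 hp
  simp only [mul_ite, mul_zero]
  rw [sum_ite_eq, if_pos (mem_range.2 (by omega)), cheb, Polynomial.Chebyshev.T_natAbs]
  simp [mul_comm]

theorem connCoeff_le (j n : ℕ) : connCoeff j n ≤
    ∑ m ∈ range (n + 1), if j + 2 * m = n then 2 * (wallis m * wallis (m + j)) else 0 := by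
  have key : ∑ p ∈ antidiagonal n, (if p.1 + j = p.2 then wallis p.1 * wallis p.2 else 0) =
      ∑ m ∈ range (n + 1), if j + 2 * m = n then wallis m * wallis (m + j) else 0 := by
    rw [Nat.sum_antidiagonal_eq_sum_range_succ_mk]
    refine sum_congr rfl fun m hm => ?_
    have := mem_range.1 hm
    by_cases h : j + 2 * m = n
    · have h1 : n - m = m + j := by omega
      simp [h, h1]
    · rw [if_neg h, if_neg (by simp only; omega)]
  calc connCoeff j n ≤ ∑ p ∈ antidiagonal n,
        ((if p.1 + j = p.2 then wallis p.1 * wallis p.2 else 0) +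
          (if p.2 + j = p.1 then wallis p.2 * wallis p.1 else 0)) := by
        refine sum_le_sum fun p _ => ?_
        have hpos := mul_pos (wallis_pos p.1) (wallis_pos p.2)
        rw [mul_comm (wallis p.2)]
        split_ifs <;> first | omega | linarith
    _ = _ := by
        rw [sum_add_distrib, ← Nat.sum_antidiagonal_swap
          (f := fun p : ℕ × ℕ => if p.2 + j = p.1 then wallis p.2 * wallis p.1 else 0)]
        simp only [Prod.fst_swap, Prod.snd_swap]
        rw [key, ← two_mul, mul_sum]
        simp only [mul_ite, mul_zero]

theorem one_div_sqrt_mul_le {x J : ℝ} (hx : 2 ≤ x) (hJ : 0 < J) :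
    √J / (2 * √x * (x + J)) ≤ √x / (√x + √J) - √(x - 2) / (√(x - 2) + √J) := by
  have hs : 0 < √x := Real.sqrt_pos.2 (by linarith)
  have ht : 0 < √J := Real.sqrt_pos.2 hJ
  have hr : 0 ≤ √(x - 2) := Real.sqrt_nonneg _
  have hs2 : √x ^ 2 = x := Real.sq_sqrt (by linarith)
  have ht2 : √J ^ 2 = J := Real.sq_sqrt hJ.le
  have hr2 : √(x - 2) ^ 2 = x - 2 := Real.sq_sqrt (by linarith)
  have hrs : √(x - 2) ≤ √x := Real.sqrt_le_sqrt (by linarith)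
  generalize √x = s at *
  generalize √J = t at *
  generalize √(x - 2) = r at *
  have e : s / (s + t) - r / (r + t) = t * (s - r) / ((s + t) * (r + t)) := by
    field_simp
    ring
  rw [e, ← hs2, ← ht2, div_le_div_iff₀ (by positivity) (by positivity)]
  have h1 : 1 ≤ s * (s - r) := by nlinarith
  have h2 : (s + t) * (r + t) ≤ 2 * (s ^ 2 + t ^ 2) := by nlinarith [sq_nonneg (s - t)]
  calc t * ((s + t) * (r + t)) ≤ t * (2 * (s ^ 2 + t ^ 2)) := by gcongr
    _ ≤ t * (2 * (s ^ 2 + t ^ 2)) * (s * (s - r)) := le_mul_of_one_le_right (by positivity) h1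
    _ = t * (s - r) * (2 * s * (s ^ 2 + t ^ 2)) := by ring

theorem wallis_mul_div_sqrt_le (m j : ℕ) (hm : 0 < m) :
    2 * (wallis m * wallis (m + j)) / √(j + 2 * m + 1) ≤
      2 / (√(2 * m) * (2 * m + (j + 1))) := by
  have hm1 : (1 : ℝ) ≤ m := by exact_mod_cast hm
  have h1 : wallis m ≤ 1 / √(2 * m) :=
    (wallis_le m).trans (one_div_le_one_div_of_le (by positivity)
      (Real.sqrt_le_sqrt (by linarith)))
  have h2 : wallis (m + j) ≤ 1 / √(j + 2 * m + 1) :=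
    (wallis_le _).trans (one_div_le_one_div_of_le (by positivity)
      (Real.sqrt_le_sqrt (by push_cast; have : (0 : ℝ) ≤ j := j.cast_nonneg; linarith)))
  have hs : √((j : ℝ) + 2 * m + 1) * √((j : ℝ) + 2 * m + 1) = j + 2 * m + 1 :=
    Real.mul_self_sqrt (by positivity)
  calc 2 * (wallis m * wallis (m + j)) / √(j + 2 * m + 1)
      ≤ 2 * (1 / √(2 * m) * (1 / √(j + 2 * m + 1))) / √(j + 2 * m + 1) := by
        have := (wallis_pos (m + j)).le
        gcongr
    _ = 2 / (√(2 * m) * (√(j + 2 * m + 1) * √(j + 2 * m + 1))) := by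
        field_simp
    _ = _ := by rw [hs]; ring_nf

theorem sum_wallis_mul_div_sqrt_le (j K : ℕ) :
    ∑ m ∈ range K, 2 * (wallis m * wallis (m + j)) / √(j + 2 * m + 1) ≤ 6 / √(j + 1) := by
  have hJ : (0 : ℝ) < j + 1 := by positivity
  have ht : 0 < √((j : ℝ) + 1) := Real.sqrt_pos.2 hJ
  have key : ∑ m ∈ range (K + 1), 2 * (wallis m * wallis (m + j)) / √(j + 2 * m + 1) ≤
      2 / √(j + 1) + 4 / √(j + 1) * (√(2 * K) / (√(2 * K) + √(j + 1))) := by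
    induction K with
    | zero =>
      simp only [zero_add, range_one, sum_singleton, wallis_zero, one_mul, Nat.cast_zero, mul_zero,
        add_zero, Real.sqrt_zero, zero_div]
      have h : wallis j ≤ 1 := (wallis_le j).trans (by
        rw [div_le_one (by positivity), Real.one_le_sqrt]
        linarith [(j.cast_nonneg : (0 : ℝ) ≤ j)])
      gcongr
      linarith
    | succ K ih =>
      rw [sum_range_succ]
      have h1 := wallis_mul_div_sqrt_le (K + 1) j K.succ_pos
      have h2 := one_div_sqrt_mul_le (x := 2 * ((K + 1 : ℕ) : ℝ)) (J := j + 1)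
        (by push_cast; linarith [(K.cast_nonneg : (0 : ℝ) ≤ K)]) hJ
      rw [show 2 * ((K + 1 : ℕ) : ℝ) - 2 = 2 * K by push_cast; ring] at h2
      have h3 := mul_le_mul_of_nonneg_left h2 (show 0 ≤ 4 / √((j : ℝ) + 1) by positivity)
      have h4 : 4 / √((j : ℝ) + 1) * (√(j + 1) / (2 * √(2 * ((K + 1 : ℕ) : ℝ)) *
          (2 * ((K + 1 : ℕ) : ℝ) + (j + 1)))) =
          2 / (√(2 * ((K + 1 : ℕ) : ℝ)) * (2 * ((K + 1 : ℕ) : ℝ) + (j + 1))) := by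
        field_simp
        norm_num
      rw [h4] at h3
      linarith
  calc _ ≤ ∑ m ∈ range (K + 1), 2 * (wallis m * wallis (m + j)) / √(j + 2 * m + 1) := by
        refine sum_le_sum_of_subset_of_nonneg (range_mono K.le_succ) fun m _ _ => ?_
        have := wallis_pos m
        have := wallis_pos (m + j)
        positivity
    _ ≤ _ := key
    _ ≤ 2 / √(j + 1) + 4 / √(j + 1) * 1 := by
        gcongr
        rw [div_le_one (by positivity)]
        linarith
    _ = _ := by ring

theorem sum_connCoeff_row_le (M j : ℕ) :
    ∑ n ∈ range (M + 1), connCoeff j n * (1 / √(n + 1)) ≤ 6 * (1 / √(j + 1)) := by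
  calc ∑ n ∈ range (M + 1), connCoeff j n * (1 / √(n + 1))
      ≤ ∑ n ∈ range (M + 1), ∑ m ∈ range (M + 1),
          if j + 2 * m = n then 2 * (wallis m * wallis (m + j)) / √(j + 2 * m + 1) else 0 := by
        refine sum_le_sum fun n hn => ?_
        have hnM := mem_range.1 hn
        calc connCoeff j n * (1 / √(n + 1))
            ≤ (∑ m ∈ range (n + 1),
                if j + 2 * m = n then 2 * (wallis m * wallis (m + j)) else 0) *
                (1 / √(n + 1)) := by
              gcongr
              exact connCoeff_le j n
          _ = ∑ m ∈ range (n + 1),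
                if j + 2 * m = n then 2 * (wallis m * wallis (m + j)) / √(j + 2 * m + 1)
                else 0 := by
              rw [sum_mul]
              refine sum_congr rfl fun m _ => ?_
              split_ifs with h
              · rw [← h]; push_cast; ring
              · simp
          _ ≤ _ := by
              refine sum_le_sum_of_subset_of_nonneg (range_mono (by omega)) fun m _ _ => ?_
              have := wallis_pos m
              have := wallis_pos (m + j)
              split_ifs <;> positivity
    _ = ∑ m ∈ range (M + 1), ∑ n ∈ range (M + 1),
          if j + 2 * m = n then 2 * (wallis m * wallis (m + j)) / √(j + 2 * m + 1) else 0 :=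
        sum_comm
    _ ≤ ∑ m ∈ range (M + 1), 2 * (wallis m * wallis (m + j)) / √(j + 2 * m + 1) := by
        refine sum_le_sum fun m _ => ?_
        have := wallis_pos m
        have := wallis_pos (m + j)
        rw [sum_ite_eq]
        split_ifs
        · exact le_rfl
        · positivity
    _ ≤ 6 / √(j + 1) := sum_wallis_mul_div_sqrt_le j (M + 1)
    _ = _ := by ring

theorem sum_one_div_sqrt_odd_le (K : ℕ) : ∑ m ∈ range K, 1 / √(2 * (m : ℝ) + 1) ≤ √(2 * K) := by
  induction K with
  | zero => simp
  | succ K ih =>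
    rw [sum_range_succ]
    have hs : 0 < √(2 * (K : ℝ) + 1) := Real.sqrt_pos.2 (by positivity)
    have hs2 : √(2 * (K : ℝ) + 1) ^ 2 = 2 * K + 1 := Real.sq_sqrt (by positivity)
    have ha2 : √(2 * (K : ℝ)) ^ 2 = 2 * K := Real.sq_sqrt (by positivity)
    have hb2 : √(2 * ((K + 1 : ℕ) : ℝ)) ^ 2 = 2 * K + 2 := by
      rw [Real.sq_sqrt (by positivity)]; push_cast; ring
    have ha : 0 ≤ √(2 * (K : ℝ)) := Real.sqrt_nonneg _
    have hb : 0 ≤ √(2 * ((K + 1 : ℕ) : ℝ)) := Real.sqrt_nonneg _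
    generalize √(2 * (K : ℝ) + 1) = s at *
    generalize √(2 * (K : ℝ)) = a at *
    generalize √(2 * ((K + 1 : ℕ) : ℝ)) = b at *
    have hab : a ≤ b := by nlinarith
    have h1 : a + b ≤ 2 * s := by
      refine le_of_sq_le_sq (by nlinarith [sq_nonneg (a - b)]) (by positivity)
    have h2 : 1 / s ≤ b - a := by
      rw [div_le_iff₀ hs]
      nlinarith
    linarith

theorem one_div_sqrt_mul_one_div_sqrt_le {x y : ℝ} (hx : 0 < x) (hy : 0 < y) :
    1 / √x * (1 / √y) ≤ (1 / √x + 1 / √y) / √(x + y) := by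
  have hx' := Real.sqrt_pos.2 hx
  have hy' := Real.sqrt_pos.2 hy
  have h : √(x + y) ≤ √x + √y := by
    rw [Real.sqrt_le_left (by positivity)]
    nlinarith [Real.sq_sqrt hx.le, Real.sq_sqrt hy.le]
  rw [le_div_iff₀ (Real.sqrt_pos.2 (by linarith))]
  calc 1 / √x * (1 / √y) * √(x + y) ≤ 1 / √x * (1 / √y) * (√x + √y) := by gcongr
    _ = _ := by field_simp; ring

theorem sum_connCoeff_col_le (M n : ℕ) :
    ∑ j ∈ range (M + 1), connCoeff j n * (1 / √(j + 1)) ≤ 4 * (1 / √(n + 1)) := by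
  set K := n / 2 + 1 with hK
  have hn1 : 0 < √((n : ℝ) + 1) := Real.sqrt_pos.2 (by positivity)
  have hn2 : 0 < √((n : ℝ) + 2) := Real.sqrt_pos.2 (by positivity)
  have hKn : √(2 * (K : ℝ)) ≤ √((n : ℝ) + 2) := by
    apply Real.sqrt_le_sqrt
    have : 2 * K ≤ n + 2 := by omega
    exact_mod_cast this
  have hrefl : ∑ m ∈ range K, 1 / √(((n - 2 * m : ℕ) : ℝ) + 1) ≤ √(2 * K) := by
    rw [← sum_range_reflect]
    refine le_trans (sum_le_sum fun m hm => ?_) (sum_one_div_sqrt_odd_le K)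
    have := mem_range.1 hm
    refine one_div_le_one_div_of_le (by positivity) (Real.sqrt_le_sqrt ?_)
    have : 2 * m + 1 ≤ n - 2 * (K - 1 - m) + 1 := by omega
    exact_mod_cast this
  calc ∑ j ∈ range (M + 1), connCoeff j n * (1 / √(j + 1))
      ≤ ∑ j ∈ range (M + 1), ∑ m ∈ range (n + 1),
          if j + 2 * m = n then 2 * (wallis m * wallis (m + j)) * (1 / √(j + 1)) else 0 := by
        refine sum_le_sum fun j _ => ?_
        refine (mul_le_mul_of_nonneg_right (connCoeff_le j n) (by positivity)).trans_eq ?_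
        rw [sum_mul]
        exact sum_congr rfl fun m _ => ite_zero_mul _ _ _
    _ = ∑ m ∈ range (n + 1), ∑ j ∈ range (M + 1),
          if j + 2 * m = n then 2 * (wallis m * wallis (m + j)) * (1 / √(j + 1)) else 0 :=
        sum_comm
    _ ≤ ∑ m ∈ range (n + 1), if m < K then
          2 * (wallis m * wallis (n - m)) * (1 / √(((n - 2 * m : ℕ) : ℝ) + 1)) else 0 := by
        refine sum_le_sum fun m _ => ?_
        by_cases hm : m < K
        · rw [if_pos hm]
          have h1 : ∀ j, (if j + 2 * m = n then
              2 * (wallis m * wallis (m + j)) * (1 / √((j : ℝ) + 1)) else 0) =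
              if n - 2 * m = j then
              2 * (wallis m * wallis (n - m)) * (1 / √(((n - 2 * m : ℕ) : ℝ) + 1)) else 0 := by
            intro j
            by_cases h : j + 2 * m = n
            · rw [if_pos h, if_pos (by omega), show n - m = m + j by omega,
                show n - 2 * m = j by omega]
            · rw [if_neg h, if_neg (by omega)]
          simp_rw [h1]
          rw [sum_ite_eq]
          have := wallis_pos m
          have := wallis_pos (n - m)
          split_ifs
          · exact le_rfl
          · positivity
        · rw [if_neg hm]
          refine (sum_eq_zero fun j _ => if_neg ?_).le
          omega
    _ = ∑ m ∈ range K,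
          2 * (wallis m * wallis (n - m)) * (1 / √(((n - 2 * m : ℕ) : ℝ) + 1)) := by
        rw [← sum_filter]
        refine sum_congr ?_ fun _ _ => rfl
        ext m
        simp only [mem_filter, mem_range]
        omega
    _ ≤ ∑ m ∈ range K, 2 / (√(n + 1) * √(n + 2)) *
          (1 / √(2 * (m : ℝ) + 1) + 1 / √(((n - 2 * m : ℕ) : ℝ) + 1)) := by
        refine sum_le_sum fun m hm => ?_
        have hm' := mem_range.1 hm
        have h1 := wallis_le m
        have h2 : wallis (n - m) ≤ 1 / √(n + 1) := by
          refine (wallis_le _).trans (one_div_le_one_div_of_le hn1 (Real.sqrt_le_sqrt ?_))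
          have : n + 1 ≤ 2 * (n - m) + 1 := by omega
          exact_mod_cast this
        have h3 := one_div_sqrt_mul_one_div_sqrt_le (x := 2 * (m : ℝ) + 1)
          (y := ((n - 2 * m : ℕ) : ℝ) + 1) (by positivity) (by positivity)
        have h4 : 2 * (m : ℝ) + 1 + (((n - 2 * m : ℕ) : ℝ) + 1) = n + 2 := by
          have : 2 * m + 1 + (n - 2 * m + 1) = n + 2 := by omega
          exact_mod_cast this
        rw [h4] at h3
        calc 2 * (wallis m * wallis (n - m)) * (1 / √(((n - 2 * m : ℕ) : ℝ) + 1))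
            ≤ 2 * (1 / √(2 * (m : ℝ) + 1) * (1 / √(n + 1))) *
                (1 / √(((n - 2 * m : ℕ) : ℝ) + 1)) := by
              have := (wallis_pos (n - m)).le
              gcongr
          _ = 2 / √(n + 1) * (1 / √(2 * (m : ℝ) + 1) *
                (1 / √(((n - 2 * m : ℕ) : ℝ) + 1))) := by ring
          _ ≤ 2 / √(n + 1) * ((1 / √(2 * (m : ℝ) + 1) +
                1 / √(((n - 2 * m : ℕ) : ℝ) + 1)) / √(n + 2)) := by gcongr
          _ = _ := by ring
    _ ≤ 2 / (√(n + 1) * √(n + 2)) * (√(n + 2) + √(n + 2)) := by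
        rw [← mul_sum, sum_add_distrib]
        gcongr
        · exact (sum_one_div_sqrt_odd_le K).trans hKn
        · exact hrefl.trans hKn
    _ = _ := by field_simp; norm_num

theorem schur_test {ι κ : Type*} [Fintype ι] [Fintype κ] (A : ι → κ → ℝ) (u : κ → ℝ) (v : ι → ℝ)
    (hA : ∀ i k, 0 ≤ A i k) (hu : ∀ k, 0 < u k) {α β : ℝ} (hα : 0 ≤ α)
    (hrow : ∀ i, ∑ k, A i k * u k ≤ α * v i) (hcol : ∀ k, ∑ i, A i k * v i ≤ β * u k)
    (d : κ → ℝ) : ∑ i, (∑ k, A i k * d k) ^ 2 ≤ α * β * ∑ k, d k ^ 2 := by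
  have hq : ∀ i k, 0 ≤ A i k * (d k ^ 2 / u k) := fun i k =>
    mul_nonneg (hA i k) (div_nonneg (sq_nonneg _) (hu k).le)
  calc ∑ i, (∑ k, A i k * d k) ^ 2
      ≤ ∑ i, (∑ k, A i k * u k) * ∑ k, A i k * (d k ^ 2 / u k) := by
        refine sum_le_sum fun i _ => ?_
        refine sum_sq_le_sum_mul_sum_of_sq_le_mul _
          (fun k _ => mul_nonneg (hA i k) (hu k).le) (fun k _ => hq i k) fun k _ => ?_
        have := (hu k).ne'
        exact le_of_eq (by field_simp)
    _ ≤ ∑ i, (α * v i) * ∑ k, A i k * (d k ^ 2 / u k) := by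
        refine sum_le_sum fun i _ => ?_
        exact mul_le_mul_of_nonneg_right (hrow i) (sum_nonneg fun k _ => hq i k)
    _ = α * ∑ k, (∑ i, A i k * v i) * (d k ^ 2 / u k) := by
        simp only [mul_sum, sum_mul]
        rw [sum_comm]
        exact sum_congr rfl fun _ _ => sum_congr rfl fun _ _ => by ring
    _ ≤ α * ∑ k, (β * u k) * (d k ^ 2 / u k) := by
        refine mul_le_mul_of_nonneg_left (sum_le_sum fun k _ => ?_) hα
        exact mul_le_mul_of_nonneg_right (hcol k) (div_nonneg (sq_nonneg _) (hu k).le)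
    _ = _ := by
        rw [mul_assoc, mul_sum (a := β)]
        congr 1
        refine sum_congr rfl fun k _ => ?_
        have := (hu k).ne'
        field_simp

/-- The upper triangular matrix converting Legendre coefficients into Chebyshev coefficients. -/
noncomputable def connMatrix (M : ℕ) : Matrix (Fin (M + 1)) (Fin (M + 1)) ℝ :=
  Matrix.of fun j n => connCoeff j n

theorem legVand_eq_mul (N M : ℕ) : legVand N M = chebVand N M * connMatrix M := by
  ext i n
  rw [Matrix.mul_apply]
  simp only [legVand, chebVand, connMatrix, Matrix.of_apply]
  rw [legendre_eval_eq_sum M n (Nat.lt_succ_iff.1 n.2),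
    Fin.sum_univ_eq_sum_range (fun j => cheb j (xequi N i) * connCoeff j n)]

theorem isUnit_det_connMatrix (M : ℕ) : IsUnit (connMatrix M).det := by
  have h : (connMatrix M).IsUpperTriangular := fun j n h => connCoeff_eq_zero (by simpa using h)
  rw [Matrix.det_of_isUpperTriangular h]
  exact (prod_pos fun (n : Fin (M + 1)) _ => connCoeff_self_pos n).ne'.isUnit

theorem sum_sq_connMatrix_mulVec_le (M : ℕ) (d : Fin (M + 1) → ℝ) :
    ∑ j, ((connMatrix M).mulVec d j) ^ 2 ≤ 25 * ∑ n, d n ^ 2 := by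
  have h := schur_test (fun j n : Fin (M + 1) => connCoeff j n) (fun n => 1 / √((n : ℝ) + 1))
    (fun n => 1 / √((n : ℝ) + 1)) (fun _ _ => connCoeff_nonneg _ _) (fun _ => by positivity)
    (α := 6) (β := 4) (by norm_num)
    (fun j => by
      rw [Fin.sum_univ_eq_sum_range (fun n => connCoeff j n * (1 / √((n : ℝ) + 1)))]
      exact sum_connCoeff_row_le M j)
    (fun n => by
      rw [Fin.sum_univ_eq_sum_range (fun j => connCoeff j n * (1 / √((j : ℝ) + 1)))]
      exact sum_connCoeff_col_le M n) d
  have h2 : 0 ≤ ∑ n, d n ^ 2 := sum_nonneg fun _ _ => sq_nonneg _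
  calc _ ≤ 6 * 4 * ∑ n, d n ^ 2 := h
    _ ≤ _ := by linarith

theorem enorm2_nonneg {n : ℕ} (v : Fin n → ℝ) : 0 ≤ enorm2 v := Real.sqrt_nonneg _

theorem sigmaMin_mul_le {m n : ℕ} (A : Matrix (Fin m) (Fin n) ℝ) (v : Fin n → ℝ) :
    sigmaMin A * enorm2 v ≤ enorm2 (A.mulVec v) := by
  have smul (k : ℕ) (t : ℝ) (w : Fin k → ℝ) : enorm2 (t • w) = |t| * enorm2 w := by
    simp only [enorm2, Pi.smul_apply, smul_eq_mul, mul_pow, ← mul_sum]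
    rw [Real.sqrt_mul (sq_nonneg t), Real.sqrt_sq_eq_abs]
  rcases (enorm2_nonneg v).eq_or_lt with h | h
  · rw [← h, mul_zero]
    exact enorm2_nonneg _
  rw [← le_div_iff₀ h]
  refine csInf_le ⟨0, ?_⟩ ⟨(enorm2 v)⁻¹ • v, ?_, ?_⟩
  · rintro r ⟨w, -, rfl⟩
    exact enorm2_nonneg _
  · rw [smul, abs_of_pos (inv_pos.2 h), inv_mul_cancel₀ h.ne']
  · rw [Matrix.mulVec_smul, smul, abs_of_pos (inv_pos.2 h), div_eq_inv_mul]

theorem sigmaMin_nonneg {m n : ℕ} (A : Matrix (Fin m) (Fin n) ℝ) : 0 ≤ sigmaMin A :=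
  Real.sInf_nonneg (by rintro r ⟨w, -, rfl⟩; exact enorm2_nonneg _)

theorem sigmaMin_legVand_le (N M : ℕ) :
    sigmaMin (legVand N M) / 5 ≤ sigmaMin (chebVand N M) := by
  refine le_csInf ⟨_, Pi.single 0 1, ?_, rfl⟩ ?_
  · simp [enorm2, Pi.single_apply]
  rintro r ⟨c, hc, rfl⟩
  set d := (connMatrix M)⁻¹.mulVec c with hd
  have hcd : (connMatrix M).mulVec d = c := by
    rw [hd, Matrix.mulVec_mulVec, Matrix.mul_nonsing_inv _ (isUnit_det_connMatrix M),
      Matrix.one_mulVec]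
  have h1 : enorm2 c ≤ 5 * enorm2 d := by
    have h := sum_sq_connMatrix_mulVec_le M d
    rw [hcd] at h
    calc enorm2 c ≤ √(25 * ∑ n, d n ^ 2) := Real.sqrt_le_sqrt h
      _ = 5 * enorm2 d := by
        rw [Real.sqrt_mul (by norm_num), show (25 : ℝ) = 5 ^ 2 by norm_num,
          Real.sqrt_sq (by norm_num), enorm2]
  have h2 := sigmaMin_mul_le (legVand N M) d
  rw [legVand_eq_mul, ← Matrix.mulVec_mulVec, hcd, ← legVand_eq_mul] at h2
  rw [hc] at h1
  nlinarith [sigmaMin_nonneg (legVand N M)]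

/-- The cosine polynomial with coefficient vector `c`. -/
noncomputable def cosPoly {n : ℕ} (c : Fin n → ℝ) (θ : ℝ) : ℝ := ∑ j, c j * Real.cos (j * θ)

/-- The derivative of `cosPoly c`. -/
noncomputable def cosPolyDeriv {n : ℕ} (c : Fin n → ℝ) (θ : ℝ) : ℝ :=
  ∑ j, c j * (-Real.sin (j * θ) * j)

theorem hasDerivAt_cosPoly {n : ℕ} (c : Fin n → ℝ) (θ : ℝ) :
    HasDerivAt (cosPoly c) (cosPolyDeriv c θ) θ := by
  unfold cosPoly cosPolyDeriv
  refine HasDerivAt.fun_sum fun j _ => HasDerivAt.const_mul _ ?_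
  exact (Real.hasDerivAt_cos _).comp θ (by simpa using (hasDerivAt_id θ).const_mul (j : ℝ))

theorem continuous_cosPoly {n : ℕ} (c : Fin n → ℝ) : Continuous (cosPoly c) := by
  unfold cosPoly
  fun_prop

theorem continuous_cosPolyDeriv {n : ℕ} (c : Fin n → ℝ) : Continuous (cosPolyDeriv c) := by
  unfold cosPolyDeriv
  fun_prop

theorem chebVand_mulVec_s5 (N M : ℕ) (c : Fin (M + 1) → ℝ) (i : Fin (N + 1)) (θ : ℝ)
    (h : Real.cos θ = xequi N i) : (chebVand N M).mulVec c i = cosPoly c θ := by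
  simp only [Matrix.mulVec, dotProduct, chebVand, Matrix.of_apply, cheb, cosPoly, ← h,
    Polynomial.Chebyshev.T_real_cos, Int.cast_natCast, mul_comm]

theorem integral_cos_mul_cos_of_ne {j k : ℕ} (h : j ≠ k) :
    ∫ θ in 0..Real.pi, Real.cos (j * θ) * Real.cos (k * θ) = 0 := by
  have := Polynomial.Chebyshev.integral_eval_T_real_mul_eval_T_real_measureT_of_ne h
  rw [Polynomial.Chebyshev.integral_measureT_eq_integral_cos] at this
  simpa [Polynomial.Chebyshev.T_real_cos] using this

theorem integral_cos_mul_self {j : ℕ} (h : j ≠ 0) :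
    ∫ θ in 0..Real.pi, Real.cos (j * θ) * Real.cos (j * θ) = Real.pi / 2 := by
  have := Polynomial.Chebyshev.integral_T_real_mul_self_measureT_of_ne_zero h
  rw [Polynomial.Chebyshev.integral_measureT_eq_integral_cos] at this
  simpa [Polynomial.Chebyshev.T_real_cos] using this

theorem integral_cos_add_eq_zero {j k : ℕ} (h : j + k ≠ 0) :
    ∫ θ in 0..Real.pi, Real.cos (j * θ + k * θ) = 0 := by
  have := integral_cos_mul_cos_of_ne h
  simpa [add_mul] using this

theorem integral_sin_mul_sin_eq {j k : ℕ} (h : j + k ≠ 0) :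
    ∫ θ in 0..Real.pi, Real.sin (j * θ) * Real.sin (k * θ) =
      ∫ θ in 0..Real.pi, Real.cos (j * θ) * Real.cos (k * θ) := by
  have h1 := integral_cos_add_eq_zero h
  simp only [Real.cos_add] at h1
  rw [intervalIntegral.integral_sub (Continuous.intervalIntegrable (by fun_prop) _ _)
    (Continuous.intervalIntegrable (by fun_prop) _ _)] at h1
  linarith

theorem integral_sq_sum_of_orthogonal {n : ℕ} (f : Fin n → ℝ → ℝ) (hf : ∀ j, Continuous (f j))
    (h : ∀ j k, j ≠ k → ∫ θ in 0..Real.pi, f j θ * f k θ = 0) (c : Fin n → ℝ) :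
    ∫ θ in 0..Real.pi, (∑ j, c j * f j θ) ^ 2 =
      ∑ j, c j ^ 2 * ∫ θ in 0..Real.pi, f j θ * f j θ := by
  simp only [sq, sum_mul_sum]
  rw [intervalIntegral.integral_finsetSum
    fun j _ => Continuous.intervalIntegrable (by fun_prop) _ _]
  refine sum_congr rfl fun j _ => ?_
  rw [intervalIntegral.integral_finsetSum
    fun j _ => Continuous.intervalIntegrable (by fun_prop) _ _]
  simp only [mul_mul_mul_comm (c _) _ (c _), intervalIntegral.integral_const_mul]
  rw [sum_eq_single j (fun k _ hk => by rw [h j k hk.symm, mul_zero]) (by simp)]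

theorem integral_cosPoly_sq {M : ℕ} (c : Fin (M + 1) → ℝ) :
    ∫ θ in 0..Real.pi, cosPoly c θ ^ 2 =
      ∑ j : Fin (M + 1), c j ^ 2 * if (j : ℕ) = 0 then Real.pi else Real.pi / 2 := by
  unfold cosPoly
  rw [integral_sq_sum_of_orthogonal (fun j θ => Real.cos ((j : ℕ) * θ)) (fun j => by fun_prop)
    fun j k h => integral_cos_mul_cos_of_ne (Fin.val_ne_of_ne h)]
  refine sum_congr rfl fun j _ => ?_
  congr 1
  split_ifs with h
  · simp [h]
  · exact integral_cos_mul_self h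

theorem integral_cosPolyDeriv_sq {M : ℕ} (c : Fin (M + 1) → ℝ) :
    ∫ θ in 0..Real.pi, cosPolyDeriv c θ ^ 2 =
      ∑ j : Fin (M + 1), c j ^ 2 * ((j : ℝ) ^ 2 * (Real.pi / 2)) := by
  have e (j k : ℕ) : ∫ θ in 0..Real.pi,
      (-Real.sin (j * θ) * j) * (-Real.sin (k * θ) * k) =
      j * k * ∫ θ in 0..Real.pi, Real.sin (j * θ) * Real.sin (k * θ) := by
    rw [← intervalIntegral.integral_const_mul]
    exact intervalIntegral.integral_congr fun θ _ => by ring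
  unfold cosPolyDeriv
  rw [integral_sq_sum_of_orthogonal (fun j θ => -Real.sin ((j : ℕ) * θ) * (j : ℕ))
    (fun j => by fun_prop) fun j k h => ?_]
  · refine sum_congr rfl fun j _ => ?_
    congr 1
    rw [e]
    by_cases h : (j : ℕ) = 0
    · simp [h]
    · rw [integral_sin_mul_sin_eq (by omega), integral_cos_mul_self h]
      ring
  · have hjk := Fin.val_ne_of_ne h
    rw [e, integral_sin_mul_sin_eq (by omega), integral_cos_mul_cos_of_ne hjk, mul_zero]

/-- The integrand dominating the sum of the squared samples of `cosPoly c`. -/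
noncomputable def sampleMajorant (N M : ℕ) {n : ℕ} (c : Fin n → ℝ) (θ : ℝ) : ℝ :=
  ((N : ℝ) / 2 + M) * cosPoly c θ ^ 2 + (M : ℝ)⁻¹ * cosPolyDeriv c θ ^ 2

theorem continuous_sampleMajorant (N M : ℕ) {n : ℕ} (c : Fin n → ℝ) :
    Continuous (sampleMajorant N M c) := by
  have := continuous_cosPoly c
  have := continuous_cosPolyDeriv c
  unfold sampleMajorant
  fun_prop

theorem integral_sampleMajorant_le (N M : ℕ) (c : Fin (M + 1) → ℝ) :
    ∫ θ in 0..Real.pi, sampleMajorant N M c θ ≤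
      ((N : ℝ) / 2 + M) * Real.pi * ∑ j, c j ^ 2 := by
  have := continuous_cosPoly c
  have := continuous_cosPolyDeriv c
  unfold sampleMajorant
  rw [intervalIntegral.integral_add (Continuous.intervalIntegrable (by fun_prop) _ _)
    (Continuous.intervalIntegrable (by fun_prop) _ _), intervalIntegral.integral_const_mul,
    intervalIntegral.integral_const_mul, integral_cosPoly_sq, integral_cosPolyDeriv_sq, mul_sum,
    mul_sum, mul_sum, ← sum_add_distrib]
  refine sum_le_sum fun j _ => ?_
  have hpi := Real.pi_pos
  by_cases h : (j : ℕ) = 0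
  · simp only [h, if_true, Nat.cast_zero]
    apply le_of_eq
    ring
  · have hj : (1 : ℝ) ≤ (j : ℕ) := by exact_mod_cast Nat.one_le_iff_ne_zero.2 h
    have hjM : ((j : ℕ) : ℝ) ≤ M := by exact_mod_cast Nat.lt_succ_iff.1 j.2
    have hM : (0 : ℝ) < M := by linarith
    have h1 : (M : ℝ)⁻¹ * ((j : ℕ) : ℝ) ^ 2 ≤ M := by
      rw [inv_mul_le_iff₀ hM]
      nlinarith
    have hN : (0 : ℝ) ≤ N := N.cast_nonneg
    simp only [h, if_false]
    calc _ = c j ^ 2 * (Real.pi / 2) * ((N : ℝ) / 2 + M + (M : ℝ)⁻¹ * ((j : ℕ) : ℝ) ^ 2) := by ring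
      _ ≤ c j ^ 2 * (Real.pi / 2) * ((N : ℝ) + 2 * M) := by
        refine mul_le_mul_of_nonneg_left ?_ (by positivity)
        linarith
      _ = _ := by ring

theorem two_mul_mul_cosPolyDeriv_le {M : ℕ} (c : Fin (M + 1) → ℝ) (g θ : ℝ) (h0 : 0 ≤ g)
    (h1 : g ≤ 1) : g * (2 * cosPoly c θ * cosPolyDeriv c θ) ≤
      M * cosPoly c θ ^ 2 + (M : ℝ)⁻¹ * cosPolyDeriv c θ ^ 2 := by
  rcases Nat.eq_zero_or_pos M with rfl | hM
  · simp [cosPolyDeriv]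
  have hM' : (0 : ℝ) < M := by exact_mod_cast hM
  have hnn : 0 ≤ M * cosPoly c θ ^ 2 + (M : ℝ)⁻¹ * cosPolyDeriv c θ ^ 2 := by positivity
  have h2 : 2 * cosPoly c θ * cosPolyDeriv c θ ≤
      M * cosPoly c θ ^ 2 + (M : ℝ)⁻¹ * cosPolyDeriv c θ ^ 2 := by
    have h := mul_nonneg (inv_nonneg.2 hM'.le)
      (sq_nonneg (M * cosPoly c θ - cosPolyDeriv c θ))
    have e : (M : ℝ)⁻¹ * (M * cosPoly c θ - cosPolyDeriv c θ) ^ 2 =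
        M * cosPoly c θ ^ 2 + (M : ℝ)⁻¹ * cosPolyDeriv c θ ^ 2 -
          2 * cosPoly c θ * cosPolyDeriv c θ := by
      field_simp
      ring
    linarith
  nlinarith

theorem cosPoly_sq_le_integral (N : ℕ) {M : ℕ} (c : Fin (M + 1) → ℝ) {a b : ℝ} (hN : 0 < N)
    (ha : 0 ≤ a) (hab : a ≤ b) (hb : b ≤ Real.pi) (h : Real.cos a - Real.cos b = 2 / N) :
    cosPoly c b ^ 2 ≤ ∫ θ in a..b, sampleMajorant N M c θ := by
  have hN' : (0 : ℝ) < N := by exact_mod_cast hN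
  have hc := continuous_cosPoly c
  have hc' := continuous_cosPolyDeriv c
  have hd : ∀ θ ∈ Set.uIcc a b, HasDerivAt
      (fun θ => ((N : ℝ) / 2 * (Real.cos a - Real.cos θ)) * cosPoly c θ ^ 2)
      ((N : ℝ) / 2 * Real.sin θ * cosPoly c θ ^ 2 + ((N : ℝ) / 2 * (Real.cos a - Real.cos θ)) *
        (2 * cosPoly c θ * cosPolyDeriv c θ)) θ := by
    intro θ _
    refine ((((Real.hasDerivAt_cos θ).const_sub (Real.cos a)).const_mul ((N : ℝ) / 2)).mul
      ((hasDerivAt_cosPoly c θ).pow 2)).congr_deriv ?_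
    simp
  have hint := intervalIntegral.integral_eq_sub_of_hasDerivAt hd
    (Continuous.intervalIntegrable (by fun_prop) _ _)
  rw [h, sub_self, mul_zero, zero_mul, sub_zero, div_mul_div_comm, mul_comm (N : ℝ) 2,
    div_self (by positivity), one_mul] at hint
  rw [← hint]
  refine intervalIntegral.integral_mono_on hab (Continuous.intervalIntegrable (by fun_prop) _ _)
    ((continuous_sampleMajorant N M c).intervalIntegrable _ _) fun θ hθ => ?_
  have hca : Real.cos θ ≤ Real.cos a :=
    Real.cos_le_cos_of_nonneg_of_le_pi ha (hθ.2.trans hb) hθ.1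
  have hcb : Real.cos b ≤ Real.cos θ :=
    Real.cos_le_cos_of_nonneg_of_le_pi (ha.trans hθ.1) hb hθ.2
  have h1 := two_mul_mul_cosPolyDeriv_le c ((N : ℝ) / 2 * (Real.cos a - Real.cos θ)) θ
    (mul_nonneg (by positivity) (by linarith)) (by
      calc (N : ℝ) / 2 * (Real.cos a - Real.cos θ) ≤ (N : ℝ) / 2 * (2 / N) := by
            gcongr
            linarith
        _ = 1 := by field_simp)
  have h2 : (N : ℝ) / 2 * Real.sin θ * cosPoly c θ ^ 2 ≤ (N : ℝ) / 2 * 1 * cosPoly c θ ^ 2 := by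
    gcongr
    exact Real.sin_le_one θ
  unfold sampleMajorant
  linarith

theorem sum_sq_chebVand_mulVec_le (N M : ℕ) (hN : 0 < N) (c : Fin (M + 1) → ℝ) :
    ∑ i, ((chebVand N M).mulVec c i) ^ 2 ≤
      (((N : ℝ) / 2 + M) * Real.pi + (M + 1)) * ∑ j, c j ^ 2 := by
  have hN' : (0 : ℝ) < N := by exact_mod_cast hN
  set θ : ℕ → ℝ := fun k => Real.arccos (2 * k / N - 1) with hθ
  have hcos : ∀ k ≤ N, Real.cos (θ k) = 2 * k / N - 1 := by
    intro k hk
    have hk' : (k : ℝ) ≤ N := by exact_mod_cast hk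
    have h0 : (0 : ℝ) ≤ 2 * k / N := by positivity
    refine Real.cos_arccos (by linarith) ?_
    have : 2 * (k : ℝ) / N ≤ 2 := by rw [div_le_iff₀ hN']; linarith
    linarith
  have hval : ∀ i : Fin (N + 1), (chebVand N M).mulVec c i = cosPoly c (θ i) := fun i =>
    chebVand_mulVec_s5 N M c i _ (hcos i (Nat.lt_succ_iff.1 i.2))
  have hend : cosPoly c (θ N) ^ 2 ≤ (M + 1) * ∑ j, c j ^ 2 := by
    have h0 : θ N = 0 := by
      simp only [hθ]
      rw [mul_div_assoc, div_self hN'.ne']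
      norm_num
    have h := sq_sum_le_card_mul_sum_sq (s := univ) (f := c)
    simpa [h0, cosPoly] using h
  have hsteps : ∀ k ∈ range N, cosPoly c (θ k) ^ 2 ≤
      -∫ t in (θ k)..(θ (k + 1)), sampleMajorant N M c t := by
    intro k hk
    have hk' := mem_range.1 hk
    rw [← intervalIntegral.integral_symm]
    refine cosPoly_sq_le_integral N c hN (Real.arccos_nonneg _) (Real.arccos_le_arccos ?_)
      (Real.arccos_le_pi _) ?_
    · push_cast
      gcongr
      linarith
    · rw [hcos _ (by omega), hcos _ (by omega)]
      push_cast
      ring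
  have hsum := sum_le_sum hsteps
  rw [sum_neg_distrib, intervalIntegral.sum_integral_adjacent_intervals
    fun k _ => (continuous_sampleMajorant N M c).intervalIntegrable _ _,
    ← intervalIntegral.integral_symm, show θ 0 = Real.pi by simp [hθ],
    show θ N = 0 by simp only [hθ]; rw [mul_div_assoc, div_self hN'.ne']; norm_num] at hsum
  simp only [hval]
  rw [Fin.sum_univ_eq_sum_range (fun k => cosPoly c (θ k) ^ 2), sum_range_succ]
  have := integral_sampleMajorant_le N M c
  linarith

theorem half_add_mul_pi_add_le (M N : ℕ) (hN : 0 < N) (hMN : (M : ℝ) ≤ √(N : ℝ) / 2) :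
    ((N : ℝ) / 2 + M) * Real.pi + (M + 1) ≤ 3 * N := by
  have hN1 : (1 : ℝ) ≤ N := by exact_mod_cast hN
  have hM0 : (0 : ℝ) ≤ M := M.cast_nonneg
  have h4 : 4 * (M : ℝ) ^ 2 ≤ N := by
    have := Real.sq_sqrt (show (0 : ℝ) ≤ N by positivity)
    nlinarith
  have hpi := Real.pi_lt_d2
  have h1 : ((N : ℝ) / 2 + M) * Real.pi ≤ ((N : ℝ) / 2 + M) * 3.15 := by gcongr
  rcases Nat.eq_zero_or_pos M with rfl | hM
  · norm_num at h1 ⊢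
    linarith
  · have hM1 : (1 : ℝ) ≤ M := by exact_mod_cast hM
    norm_num at h1
    nlinarith

theorem sigmaMax_chebVand_le (M N : ℕ) (hN : 0 < N) (hMN : (M : ℝ) ≤ √(N : ℝ) / 2) :
    sigmaMax (chebVand N M) ≤ √(3 * N) := by
  refine Real.sSup_le ?_ (Real.sqrt_nonneg _)
  rintro r ⟨c, hc, rfl⟩
  refine Real.sqrt_le_sqrt ?_
  have h1 : ∑ j, c j ^ 2 = 1 := by simpa [enorm2] using hc
  have h2 := sum_sq_chebVand_mulVec_le N M hN c
  rw [h1, mul_one] at h2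
  exact h2.trans (half_add_mul_pi_add_le M N hN hMN)

theorem sigmaMax_nonneg {m n : ℕ} (A : Matrix (Fin m) (Fin n) ℝ) : 0 ≤ sigmaMax A :=
  Real.sSup_nonneg (by rintro r ⟨w, -, rfl⟩; exact enorm2_nonneg _)

end

/-- **Theorem 3.2 of the paper**: for `M ≤ √N / 2`, the extreme singular values of
the `(N+1) × (M+1)` Chebyshev–Vandermonde matrix at equally spaced points satisfy
`σ₁(T_M)² ≤ 3N` and `σ_{M+1}(T_M)² ≥ (1/25) σ_{M+1}(P_M)²`, where `P_M` is the
corresponding Legendre–Vandermonde matrix. -/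
theorem chebyshev_vandermonde_singular_values (M N : ℕ) (hN : 0 < N)
    (hMN : (M : ℝ) ≤ Real.sqrt (N : ℝ) / 2) :
    sigmaMax (chebVand N M) ^ 2 ≤ 3 * (N : ℝ) ∧
    (1 / 25) * sigmaMin (legVand N M) ^ 2 ≤ sigmaMin (chebVand N M) ^ 2 := by
  constructor
  · calc sigmaMax (chebVand N M) ^ 2 ≤ √(3 * N) ^ 2 :=
          pow_le_pow_left₀ (sigmaMax_nonneg _) (sigmaMax_chebVand_le M N hN hMN) 2
      _ = 3 * N := Real.sq_sqrt (by positivity)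
  · calc (1 / 25) * sigmaMin (legVand N M) ^ 2 = (sigmaMin (legVand N M) / 5) ^ 2 := by ring
      _ ≤ sigmaMin (chebVand N M) ^ 2 :=
          pow_le_pow_left₀ (div_nonneg (sigmaMin_nonneg _) (by norm_num))
            (sigmaMin_legVand_le N M) 2
end
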